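/- Let T₀ ⊆ V be a subspace with formal-basis-style complement C₀ = C(T₀), let W' be an 𝔽-vector space, and let d : W' → V be a linear map whose range is contained in C₀. Let N = C(T₀ + range d) be the formal-basis-style complement of the subspace T₀ + range d. Then for every v ∈ C₀ there exists w ∈ W' such that v − d(w) ∈ N. -/

import Mathlib

/-- The index set `S(W)` of the formal-basis-style complement, defined by strong
recursion: `n ∈ S(W)` iff `e n ∉ W + span {e k : k ∈ S(W), k < n}`. -/
noncomputable def formalBasisIndexSet {𝔽 V : Type*} [Field 𝔽] [AddCommGroup V] [Module 𝔽 V]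
    (e : ℕ → V) (W : Submodule 𝔽 V) (n : ℕ) : Prop :=
  Nat.strongRecOn (motive := fun _ => Prop) n (fun n ih =>
    e n ∉ W ⊔ Submodule.span 𝔽 {v | ∃ k, ∃ h : k < n, ih k h ∧ v = e k})

/-- The formal-basis-style complement `C(W) = span {e n : n ∈ S(W)}`. -/
noncomputable def formalBasisComplement {𝔽 V : Type*} [Field 𝔽] [AddCommGroup V] [Module 𝔽 V]
    (e : ℕ → V) (W : Submodule 𝔽 V) : Submodule 𝔽 V :=
  Submodule.span 𝔽 (e '' {n | formalBasisIndexSet e W n})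

section FormalBasis

variable {𝔽 V : Type*} [Field 𝔽] [AddCommGroup V] [Module 𝔽 V]

theorem formalBasisIndexSet_iff (e : ℕ → V) (W : Submodule 𝔽 V) (n : ℕ) :
    formalBasisIndexSet e W n ↔
      e n ∉ W ⊔ Submodule.span 𝔽 (e '' {k | k < n ∧ formalBasisIndexSet e W k}) := by
  have hset : e '' {k | k < n ∧ formalBasisIndexSet e W k} =
      {v | ∃ k, ∃ _ : k < n, formalBasisIndexSet e W k ∧ v = e k} := by
    ext v
    constructor
    · rintro ⟨k, ⟨hk, hS⟩, rfl⟩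
      exact ⟨k, hk, hS, rfl⟩
    · rintro ⟨k, hk, hS, rfl⟩
      exact ⟨k, ⟨hk, hS⟩, rfl⟩
  rw [hset]
  conv_lhs => unfold formalBasisIndexSet
  rw [Nat.strongRecOn_eq]
  rfl

/-- Every `e n` lies in `W` plus the span of the selected vectors of index at most `n`. -/
theorem mem_sup_span_formalBasisIndexSet (e : ℕ → V) (W : Submodule 𝔽 V) (n : ℕ) :
    e n ∈ W ⊔ Submodule.span 𝔽 (e '' {k | k ≤ n ∧ formalBasisIndexSet e W k}) := by
  by_cases h : formalBasisIndexSet e W n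
  · exact Submodule.mem_sup_right (Submodule.subset_span ⟨n, ⟨le_rfl, h⟩, rfl⟩)
  · rw [formalBasisIndexSet_iff, not_not] at h
    refine sup_le_sup_left (Submodule.span_mono (Set.image_mono ?_)) W h
    exact fun _ hk => ⟨hk.1.le, hk.2⟩

/-- The recursion may equivalently range over all earlier vectors. -/
theorem formalBasisIndexSet_iff_notMem_sup_span_Iio (e : ℕ → V) (W : Submodule 𝔽 V) (n : ℕ) :
    formalBasisIndexSet e W n ↔ e n ∉ W ⊔ Submodule.span 𝔽 (e '' Set.Iio n) := by
  rw [formalBasisIndexSet_iff]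
  suffices h : W ⊔ Submodule.span 𝔽 (e '' {k | k < n ∧ formalBasisIndexSet e W k}) =
      W ⊔ Submodule.span 𝔽 (e '' Set.Iio n) by rw [h]
  apply le_antisymm
  · exact sup_le_sup_left (Submodule.span_mono (Set.image_mono fun _ hk => hk.1)) W
  · refine sup_le le_sup_left (Submodule.span_le.2 ?_)
    rintro _ ⟨k, hk, rfl⟩
    refine sup_le_sup_left (Submodule.span_mono (Set.image_mono ?_)) W
      (mem_sup_span_formalBasisIndexSet e W k)
    exact fun _ hj => ⟨hj.1.trans_lt hk, hj.2⟩

theorem formalBasisComplement_antitone (e : ℕ → V) :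
    Antitone (formalBasisComplement (𝔽 := 𝔽) e) := by
  intro W₁ W₂ h
  refine Submodule.span_mono (Set.image_mono fun n hn => ?_)
  rw [Set.mem_ofPred_eq, formalBasisIndexSet_iff_notMem_sup_span_Iio] at hn ⊢
  exact fun hmem => hn (sup_le_sup_right h _ hmem)

theorem codisjoint_formalBasisComplement (b : Module.Basis ℕ 𝔽 V) (W : Submodule 𝔽 V) :
    Codisjoint W (formalBasisComplement ⇑b W) := by
  rw [codisjoint_iff, eq_top_iff, ← b.span_eq, Submodule.span_le]
  rintro _ ⟨n, rfl⟩
  exact sup_le_sup_left (Submodule.span_mono (Set.image_mono fun _ hk => hk.2)) W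
    (mem_sup_span_formalBasisIndexSet b W n)

theorem disjoint_formalBasisComplement (b : Module.Basis ℕ 𝔽 V) (W : Submodule 𝔽 V) :
    Disjoint W (formalBasisComplement ⇑b W) := by
  rw [Submodule.disjoint_def]
  intro x hxW hxC
  by_contra hx
  have hsupp : (b.repr x).support.Nonempty := by simpa using hx
  set n := (b.repr x).support.max' hsupp
  have hnmem : n ∈ (b.repr x).support := Finset.max'_mem _ _
  have hnS : formalBasisIndexSet b W n := b.mem_span_image.1 hxC hnmem
  rw [formalBasisIndexSet_iff_notMem_sup_span_Iio] at hnS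
  have hrest : x - b.repr x n • b n ∈ Submodule.span 𝔽 (b '' Set.Iio n) := by
    rw [b.mem_span_image]
    intro k hk
    have hk' : b.repr x k - Finsupp.single n (b.repr x n) k ≠ 0 := by simpa using hk
    have hkn : k ≠ n := by
      rintro rfl
      simp at hk'
    rw [Finsupp.single_eq_of_ne hkn, sub_zero] at hk'
    exact lt_of_le_of_ne (Finset.le_max' _ _ (Finsupp.mem_support_iff.2 hk')) hkn
  have hlead : b.repr x n • b n ∈ W ⊔ Submodule.span 𝔽 (b '' Set.Iio n) := by
    simpa using Submodule.sub_mem _ (Submodule.mem_sup_left hxW) (Submodule.mem_sup_right hrest)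
  exact hnS ((Submodule.smul_mem_iff _ (Finsupp.mem_support_iff.1 hnmem)).1 hlead)

end FormalBasis

/-- If `d : W' → V` has range inside `C₀ = C(T₀)` and `N = C(T₀ + range d)`, then every
`v ∈ C₀` can be corrected by an element of the range of `d` to land in `N`. -/
theorem formalBasisComplement_fulfils_complement_role {𝔽 V : Type*} [Field 𝔽] [AddCommGroup V]
    [Module 𝔽 V] (b : Module.Basis ℕ 𝔽 V) (T₀ : Submodule 𝔽 V)
    {W' : Type*} [AddCommGroup W'] [Module 𝔽 W'] (d : W' →ₗ[𝔽] V)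
    (hd : LinearMap.range d ≤ formalBasisComplement ⇑b T₀) :
    ∀ v ∈ formalBasisComplement ⇑b T₀, ∃ w : W',
      v - d w ∈ formalBasisComplement ⇑b (T₀ ⊔ LinearMap.range d) := by
  intro v hv
  have hvtop : v ∈ (T₀ ⊔ LinearMap.range d) ⊔
      formalBasisComplement ⇑b (T₀ ⊔ LinearMap.range d) := by
    rw [(codisjoint_formalBasisComplement b _).eq_top]
    exact Submodule.mem_top
  obtain ⟨y, hy, c, hc, rfl⟩ := Submodule.mem_sup.1 hvtop
  obtain ⟨t, ht, _, ⟨w, rfl⟩, rfl⟩ := Submodule.mem_sup.1 hy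
  have hcC : c ∈ formalBasisComplement ⇑b T₀ :=
    formalBasisComplement_antitone b le_sup_left hc
  have htC : t ∈ formalBasisComplement ⇑b T₀ := by
    simpa using Submodule.sub_mem _ (Submodule.sub_mem _ hv hcC) (hd ⟨w, rfl⟩)
  have ht0 : t = 0 := Submodule.disjoint_def.1 (disjoint_formalBasisComplement b T₀) t ht htC
  exact ⟨w, by simpa [ht0] using hc⟩
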